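/- Let W be a union circuit over a finite set B having a unique gate g_out of out-degree 0, equipped with a trimming trim. Let R ⊆ B and let m₀ ≥ 1 be an integer. Call a binary gate g' of W R-chargeable if |trim(g') ∩ R| ≥ m₀ and both trim(left(g')) ∩ R and trim(right(g')) ∩ R differ from trim(g') ∩ R. Then for every gate g of W, the number of R-chargeable gates g' with trim(g') ∩ R ⊆ trim(g) ∩ R is at most max(0, |trim(g) ∩ R| + 1 − m₀). -/

import Mathlib

/-- A union circuit over `B = Fin nB`: a finite DAG of gates (indexed by `Fin N`, children
of a binary gate having smaller index) of in-degree `0` (input gates, `inp g = true`) or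
`2` (binary gates, with children `left g` and `right g`), each gate `g` carrying a set
`wset g ⊆ B` with `wset g = wset (left g) ∪ wset (right g)` for binary gates. -/
structure UnionCircuit (nB : ℕ) where
  N : ℕ
  inp : Fin N → Bool
  left : Fin N → Fin N
  right : Fin N → Fin N
  wset : Fin N → Finset (Fin nB)
  hacyc : ∀ g, inp g = false → left g < g ∧ right g < g
  hwset : ∀ g, inp g = false → wset g = wset (left g) ∪ wset (right g)

/-- A laminar family of sets of size at least `m ≥ 2`, in which the members strictly below a
given member `S c` fit into the two parts of a partition of `S c` into nonempty sets, has at most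
`|T| + 1 - m` members inside a set `T`, provided there is at least one. -/
lemma card_laminar_add_le {ι α : Type*} [DecidableEq ι] [DecidableEq α] (S : ι → Finset α)
    (m : ℕ) (hm : 2 ≤ m) (F : Finset ι) (T : Finset α) (hcard : ∀ c ∈ F, m ≤ (S c).card)
    (hlam : ∀ c ∈ F, ∀ d ∈ F, S c ⊆ S d ∨ S d ⊆ S c ∨ Disjoint (S c) (S d))
    (hsplit : ∀ c ∈ F, ∃ A B : Finset α, A.Nonempty ∧ B.Nonempty ∧ Disjoint A B ∧
      S c = A ∪ B ∧ ∀ d ∈ F, d ≠ c → S d ⊆ S c → S d ⊆ A ∨ S d ⊆ B)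
    (hT : ∀ c ∈ F, S c ⊆ T) (hF : F.Nonempty) : F.card + m ≤ T.card + 1 := by
  induction hn : T.card using Nat.strong_induction_on generalizing T F with
  | _ n ih =>
  subst hn
  have sub : ∀ A : Finset α, A.card < T.card →
      (F.filter fun d => S d ⊆ A).card = 0 ∨
        (F.filter fun d => S d ⊆ A).card + m ≤ A.card + 1 := by
    intro A hA
    rcases (F.filter fun d => S d ⊆ A).eq_empty_or_nonempty with h | h
    · left
      rw [h, Finset.card_empty]
    · right
      refine ih _ hA _ A ?_ ?_ ?_ ?_ h rfl
      · exact fun c hc => hcard c (Finset.mem_filter.1 hc).1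
      · exact fun c hc d hd => hlam c (Finset.mem_filter.1 hc).1 d (Finset.mem_filter.1 hd).1
      · intro c hc
        obtain ⟨A', B', h1, h2, h3, h4, h5⟩ := hsplit c (Finset.mem_filter.1 hc).1
        exact ⟨A', B', h1, h2, h3, h4, fun d hd => h5 d (Finset.mem_filter.1 hd).1⟩
      · exact fun c hc => (Finset.mem_filter.1 hc).2
  obtain ⟨c, hc, hmax⟩ := Finset.exists_max_image F (fun c => (S c).card) hF
  have hcm := hcard c hc
  by_cases hcT : S c = T
  · obtain ⟨A, B, hA, hB, hAB, hu, hd⟩ := hsplit c hc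
    have hcardT : T.card = A.card + B.card := by
      rw [← hcT, hu, Finset.card_union_of_disjoint hAB]
    have hA' := hA.card_pos
    have hB' := hB.card_pos
    have hFsub : F ⊆ insert c ((F.filter fun d => S d ⊆ A) ∪ F.filter fun d => S d ⊆ B) := by
      intro d hdF
      by_cases hdc : d = c
      · simp [hdc]
      · have := hd d hdF hdc (hcT ▸ hT d hdF)
        simp [hdF, this]
    have h1 := Finset.card_le_card hFsub
    have h2 := Finset.card_insert_le c
      ((F.filter fun d => S d ⊆ A) ∪ F.filter fun d => S d ⊆ B)
    have h3 := Finset.card_union_le (F.filter fun d => S d ⊆ A) (F.filter fun d => S d ⊆ B)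
    have h4 := sub A (by omega)
    have h5 := sub B (by omega)
    rw [hcT] at hcm
    omega
  · have hss : S c ⊂ T := (hT c hc).ssubset_of_ne hcT
    have hlt := Finset.card_lt_card hss
    have hsd := Finset.card_sdiff_add_card_eq_card (hT c hc)
    have hFsub : F ⊆ (F.filter fun d => S d ⊆ S c) ∪ F.filter fun d => S d ⊆ T \ S c := by
      intro d hdF
      have : S d ⊆ S c ∨ S d ⊆ T \ S c := by
        rcases hlam c hc d hdF with h | h | h
        · exact Or.inl (Finset.eq_of_subset_of_card_le h (hmax d hdF)).ge
        · exact Or.inl h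
        · exact Or.inr (Finset.subset_sdiff.2 ⟨hT d hdF, h.symm⟩)
      simp [hdF, this]
    have h1 := Finset.card_le_card hFsub
    have h3 := Finset.card_union_le (F.filter fun d => S d ⊆ S c)
      (F.filter fun d => S d ⊆ T \ S c)
    have h4 := sub (S c) hlt
    have h5 := sub (T \ S c) (by omega)
    omega

namespace UnionCircuit

variable {nB : ℕ} (W : UnionCircuit nB)

/-- `W.IsChild a p` says that `p` is a binary gate having `a` as a child. -/
def IsChild (a p : Fin W.N) : Prop :=
  W.inp p = false ∧ (a = W.left p ∨ a = W.right p)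

/-- `W.Below a b` says that there is a directed path from `a` to `b`. -/
def Below : Fin W.N → Fin W.N → Prop :=
  Relation.ReflTransGen W.IsChild

variable {W}

lemma IsChild.lt {a p : Fin W.N} (h : W.IsChild a p) : a < p := by
  obtain ⟨hp, rfl | rfl⟩ := h
  · exact (W.hacyc p hp).1
  · exact (W.hacyc p hp).2

lemma exists_isChild_of_ne {gout : Fin W.N}
    (huniq : ∀ g, (∀ h, W.inp h = false → W.left h ≠ g ∧ W.right h ≠ g) → g = gout)
    {a : Fin W.N} (ha : a ≠ gout) : ∃ p, W.IsChild a p := by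
  by_contra! hno
  exact ha (huniq a fun h hh =>
    ⟨fun e => hno h ⟨hh, Or.inl e.symm⟩, fun e => hno h ⟨hh, Or.inr e.symm⟩⟩)

lemma below_out {gout : Fin W.N}
    (huniq : ∀ g, (∀ h, W.inp h = false → W.left h ≠ g ∧ W.right h ≠ g) → g = gout)
    (a : Fin W.N) : W.Below a gout := by
  induction a using WellFoundedGT.induction with
  | _ a ih =>
  by_cases ha : a = gout
  · subst ha
    exact .refl
  · obtain ⟨p, hp⟩ := exists_isChild_of_ne huniq ha
    exact .head hp (ih p hp.lt)

lemma IsChild.trim_subset {trim : Fin W.N → Finset (Fin nB)}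
    (htbin : ∀ g, W.inp g = false →
      trim g = trim (W.left g) ∪ trim (W.right g) ∧
        Disjoint (trim (W.left g)) (trim (W.right g)))
    {a p : Fin W.N} (h : W.IsChild a p) : trim a ⊆ trim p := by
  obtain ⟨hp, rfl | rfl⟩ := h
  · rw [(htbin p hp).1]
    exact Finset.subset_union_left
  · rw [(htbin p hp).1]
    exact Finset.subset_union_right

lemma Below.trim_subset {trim : Fin W.N → Finset (Fin nB)}
    (htbin : ∀ g, W.inp g = false →
      trim g = trim (W.left g) ∪ trim (W.right g) ∧
        Disjoint (trim (W.left g)) (trim (W.right g)))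
    {a b : Fin W.N} (h : W.Below a b) : trim a ⊆ trim b := by
  induction h with
  | refl => exact subset_rfl
  | tail _ hc ih => exact ih.trans (hc.trim_subset htbin)

lemma IsChild.eq_of_mem_trim {trim : Fin W.N → Finset (Fin nB)}
    (htbin : ∀ g, W.inp g = false →
      trim g = trim (W.left g) ∪ trim (W.right g) ∧
        Disjoint (trim (W.left g)) (trim (W.right g)))
    {a b p : Fin W.N} (ha : W.IsChild a p) (hb : W.IsChild b p)
    {x : Fin nB} (hxa : x ∈ trim a) (hxb : x ∈ trim b) : a = b := by
  have hdis := Finset.disjoint_left.1 (htbin p ha.1).2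
  obtain ⟨-, rfl | rfl⟩ := ha <;> obtain ⟨-, rfl | rfl⟩ := hb
  · rfl
  · exact absurd hxb (hdis hxa)
  · exact absurd hxa (hdis hxb)
  · rfl

/-- Two gates whose trimmed sets share an element lie on a common directed path. -/
lemma below_or_below {trim : Fin W.N → Finset (Fin nB)}
    (htbin : ∀ g, W.inp g = false →
      trim g = trim (W.left g) ∪ trim (W.right g) ∧
        Disjoint (trim (W.left g)) (trim (W.right g)))
    {gout : Fin W.N}
    (huniq : ∀ g, (∀ h, W.inp h = false → W.left h ≠ g ∧ W.right h ≠ g) → g = gout)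
    {x : Fin nB} {a b : Fin W.N} (hxa : x ∈ trim a) (hxb : x ∈ trim b) :
    W.Below a b ∨ W.Below b a := by
  induction a using WellFoundedGT.induction with
  | _ a ih =>
  by_cases ha : a = gout
  · subst ha
    exact Or.inr (below_out huniq b)
  · obtain ⟨p, hp⟩ := exists_isChild_of_ne huniq ha
    rcases ih p hp.lt (hp.trim_subset htbin hxa) with h | h
    · exact Or.inl (.head hp h)
    · rcases Relation.ReflTransGen.cases_tail h with rfl | ⟨q, hbq, hq⟩
      · exact Or.inl (.single hp)
      · have hbq : W.Below b q := hbq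
        obtain rfl := hp.eq_of_mem_trim htbin hq hxa (hbq.trim_subset htbin hxb)
        exact Or.inr hbq

lemma Below.trim_subset_left_or_right {trim : Fin W.N → Finset (Fin nB)}
    (htbin : ∀ g, W.inp g = false →
      trim g = trim (W.left g) ∪ trim (W.right g) ∧
        Disjoint (trim (W.left g)) (trim (W.right g)))
    {a b : Fin W.N} (h : W.Below a b) (hne : a ≠ b) :
    W.inp b = false ∧ (trim a ⊆ trim (W.left b) ∨ trim a ⊆ trim (W.right b)) := by
  rcases Relation.ReflTransGen.cases_tail h with rfl | ⟨q, haq, hb, rfl | rfl⟩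
  · exact absurd rfl hne
  · exact ⟨hb, Or.inl (Below.trim_subset htbin haq)⟩
  · exact ⟨hb, Or.inr (Below.trim_subset htbin haq)⟩

end UnionCircuit

/-- Let `W` be a union circuit with a unique gate `g_out` of out-degree `0`, equipped with a
trimming `trim`.  Let `R ⊆ B` and `m₀ ≥ 1`.  A binary gate `g'` is `R`-chargeable if
`|trim g' ∩ R| ≥ m₀` and both `trim (left g') ∩ R` and `trim (right g') ∩ R` differ from
`trim g' ∩ R`.  Then for every gate `g`, the number of `R`-chargeable gates `g'` with
`trim g' ∩ R ⊆ trim g ∩ R` is at most `max 0 (|trim g ∩ R| + 1 − m₀)`. -/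
theorem stmt16 (nB : ℕ) (W : UnionCircuit nB) (gout : Fin W.N)
    (hout : ∀ h, W.inp h = false → W.left h ≠ gout ∧ W.right h ≠ gout)
    (huniq : ∀ g, (∀ h, W.inp h = false → W.left h ≠ g ∧ W.right h ≠ g) → g = gout)
    (trim : Fin W.N → Finset (Fin nB))
    (htsub : ∀ g, trim g ⊆ W.wset g)
    (htout : trim gout = W.wset gout)
    (htbin : ∀ g, W.inp g = false →
      trim g = trim (W.left g) ∪ trim (W.right g) ∧
        Disjoint (trim (W.left g)) (trim (W.right g)))
    (R : Finset (Fin nB)) (m₀ : ℕ) (hm : 1 ≤ m₀) (g : Fin W.N) :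
    ((Finset.univ.filter fun g' : Fin W.N =>
        W.inp g' = false ∧ m₀ ≤ (trim g' ∩ R).card ∧
        trim (W.left g') ∩ R ≠ trim g' ∩ R ∧ trim (W.right g') ∩ R ≠ trim g' ∩ R ∧
        trim g' ∩ R ⊆ trim g ∩ R).card : ℤ) ≤
      max 0 (((trim g ∩ R).card : ℤ) + 1 - (m₀ : ℤ)) := by
  classical
  set F := Finset.univ.filter fun g' : Fin W.N =>
        W.inp g' = false ∧ m₀ ≤ (trim g' ∩ R).card ∧
        trim (W.left g') ∩ R ≠ trim g' ∩ R ∧ trim (W.right g') ∩ R ≠ trim g' ∩ R ∧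
        trim g' ∩ R ⊆ trim g ∩ R
  have hF : ∀ c ∈ F, W.inp c = false ∧ m₀ ≤ (trim c ∩ R).card ∧
        trim (W.left c) ∩ R ≠ trim c ∩ R ∧ trim (W.right c) ∩ R ≠ trim c ∩ R ∧
        trim c ∩ R ⊆ trim g ∩ R := fun c hc => (Finset.mem_filter.1 hc).2
  have hparts : ∀ c ∈ F, (trim (W.left c) ∩ R).Nonempty ∧ (trim (W.right c) ∩ R).Nonempty ∧
      Disjoint (trim (W.left c) ∩ R) (trim (W.right c) ∩ R) ∧
      trim c ∩ R = (trim (W.left c) ∩ R) ∪ (trim (W.right c) ∩ R) := by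
    intro c hc
    obtain ⟨hb, -, hl, hr, -⟩ := hF c hc
    have hu : trim c ∩ R = (trim (W.left c) ∩ R) ∪ (trim (W.right c) ∩ R) := by
      rw [← Finset.union_inter_distrib_right, ← (htbin c hb).1]
    refine ⟨Finset.nonempty_iff_ne_empty.2 fun h => hr ?_,
      Finset.nonempty_iff_ne_empty.2 fun h => hl ?_,
      (htbin c hb).2.mono Finset.inter_subset_left Finset.inter_subset_left, hu⟩
    · rw [hu, h, Finset.empty_union]
    · rw [hu, h, Finset.union_empty]
  have hcard : ∀ c ∈ F, max m₀ 2 ≤ (trim c ∩ R).card := by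
    intro c hc
    obtain ⟨hl, hr, hd, hu⟩ := hparts c hc
    have hsum := Finset.card_union_of_disjoint hd
    rw [← hu] at hsum
    have := hl.card_pos
    have := hr.card_pos
    exact max_le (hF c hc).2.1 (by omega)
  have hlam : ∀ c ∈ F, ∀ d ∈ F, trim c ∩ R ⊆ trim d ∩ R ∨ trim d ∩ R ⊆ trim c ∩ R ∨
      Disjoint (trim c ∩ R) (trim d ∩ R) := by
    intro c _ d _
    by_cases hdis : Disjoint (trim c ∩ R) (trim d ∩ R)
    · exact Or.inr (Or.inr hdis)
    · obtain ⟨x, hxc, hxd⟩ := Finset.not_disjoint_iff.1 hdis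
      rcases UnionCircuit.below_or_below htbin huniq (Finset.mem_inter.1 hxc).1
        (Finset.mem_inter.1 hxd).1 with h | h
      · exact Or.inl (Finset.inter_subset_inter_right (h.trim_subset htbin))
      · exact Or.inr (Or.inl (Finset.inter_subset_inter_right (h.trim_subset htbin)))
  have hsplit : ∀ c ∈ F, ∃ A B : Finset (Fin nB), A.Nonempty ∧ B.Nonempty ∧ Disjoint A B ∧
      trim c ∩ R = A ∪ B ∧
      ∀ d ∈ F, d ≠ c → trim d ∩ R ⊆ trim c ∩ R → trim d ∩ R ⊆ A ∨ trim d ∩ R ⊆ B := by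
    intro c hc
    obtain ⟨hl, hr, hdis, hu⟩ := hparts c hc
    refine ⟨_, _, hl, hr, hdis, hu, fun d hd hne hsub => ?_⟩
    obtain ⟨-, -, hdl, hdr, -⟩ := hF d hd
    obtain ⟨-, -, -, hdu⟩ := hparts d hd
    have hpos : 0 < (trim d ∩ R).card := hm.trans (hF d hd).2.1
    obtain ⟨x, hx⟩ := Finset.card_pos.1 hpos
    rcases UnionCircuit.below_or_below htbin huniq (Finset.mem_inter.1 hx).1
      (Finset.mem_inter.1 (hsub hx)).1 with h | h
    · exact (h.trim_subset_left_or_right htbin hne).2.imp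
        Finset.inter_subset_inter_right Finset.inter_subset_inter_right
    · rcases (h.trim_subset_left_or_right htbin hne.symm).2 with h' | h'
      · refine absurd (Finset.Subset.antisymm ?_ ?_) hdl
        · rw [hdu]
          exact Finset.subset_union_left
        · exact hsub.trans (Finset.inter_subset_inter_right h')
      · refine absurd (Finset.Subset.antisymm ?_ ?_) hdr
        · rw [hdu]
          exact Finset.subset_union_right
        · exact hsub.trans (Finset.inter_subset_inter_right h')
  rcases F.eq_empty_or_nonempty with h | h
  · simp [h]
  · have := card_laminar_add_le (fun c => trim c ∩ R) (max m₀ 2) (le_max_right _ _) F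
      (trim g ∩ R) hcard hlam hsplit (fun c hc => (hF c hc).2.2.2.2) h
    omega
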